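/- Let N ≥ 1, d ∈ {2, 3, 4}, and 0 < g₀ < ∞. There is a constant c = c(N, d, g₀) > 0 such that for all lattice spacings a ∈ (0,1] and all gauge couplings g² ∈ (0, g₀²], the single-bond pure-gauge partition function z(a, g²) = ∫_{U(N)} exp( −(a^{d−4}/g²)·‖1 − U‖²_F ) dμ(U) satisfies z(a, g²) ≥ c · (g² a^{4−d})^{N²/2}, where μ is the normalized (probability) Haar measure on the group U(N) of N×N complex unitary matrices and ‖·‖_F is the Frobenius norm. -/

import Mathlib

open Real MeasureTheory Matrix

/-- The squared Frobenius (Hilbert–Schmidt) norm of a complex matrix: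
`‖A‖²_F = Tr(AᴴA)` (which is a real number). -/
noncomputable def frobSq {N : ℕ} (A : Matrix (Fin N) (Fin N) ℂ) : ℝ :=
  (Matrix.trace (Aᴴ * A)).re

/-- The Borel σ-algebra on the unitary group `U(N)`. -/
noncomputable instance unitaryGroupMeasurableSpace {N : ℕ} :
    MeasurableSpace (Matrix.unitaryGroup (Fin N) ℂ) := borel _

section helpers
attribute [local instance] Matrix.frobeniusNormedRing

theorem frobSq_eq_sum {N : ℕ} (A : Matrix (Fin N) (Fin N) ℂ) :
    frobSq A = ∑ i, ∑ j, ‖A i j‖ ^ 2 := by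
  unfold frobSq
  rw [Finset.sum_comm]
  simp only [Matrix.trace, Matrix.diag, Matrix.mul_apply, Matrix.conjTranspose_apply, Complex.re_sum]
  refine Finset.sum_congr rfl fun i _ => Finset.sum_congr rfl fun j _ => ?_
  rw [← Complex.normSq_eq_norm_sq, Complex.normSq_apply]
  simp

theorem frobSq_eq_norm {N : ℕ} (A : Matrix (Fin N) (Fin N) ℂ) :
    frobSq A = ‖A‖ ^ 2 := by
  have h : 0 ≤ ∑ i, ∑ j, ‖A i j‖ ^ 2 := by positivity
  have e : ‖A‖ = (∑ i, ∑ j, ‖A i j‖ ^ (2:ℝ)) ^ (1 / 2 : ℝ) := Matrix.frobenius_norm_def A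
  rw [frobSq_eq_sum, e, ← Real.sqrt_eq_rpow]
  simp only [Real.rpow_two]
  rw [Real.sq_sqrt h]

theorem frobSq_le {N : ℕ} (A : Matrix (Fin N) (Fin N) ℂ) (b : ℝ)
    (h : ∀ i j, ‖A i j‖ ^ 2 ≤ b) : frobSq A ≤ N ^ 2 * b := by
  rw [frobSq_eq_sum]
  calc _ ≤ ∑ _i : Fin N, ∑ _j : Fin N, b :=
        Finset.sum_le_sum fun i _ => Finset.sum_le_sum fun j _ => h i j
    _ = _ := by simp; ring

theorem entry_le_norm {N : ℕ} (A : Matrix (Fin N) (Fin N) ℂ) (i j) : ‖A i j‖ ≤ ‖A‖ := by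
  have h : ‖A i j‖ ^ 2 ≤ ‖A‖ ^ 2 := by
    rw [← frobSq_eq_norm, frobSq_eq_sum]
    calc ‖A i j‖ ^ 2 ≤ ∑ j, ‖A i j‖ ^ 2 :=
          Finset.single_le_sum (f := fun j => ‖A i j‖ ^ 2) (fun _ _ => by positivity) (Finset.mem_univ j)
      _ ≤ _ := Finset.single_le_sum (f := fun i => ∑ j, ‖A i j‖ ^ 2)
          (fun _ _ => by positivity) (Finset.mem_univ i)
  exact le_of_sq_le_sq h (norm_nonneg _)

theorem frobSq_translate {N : ℕ} (U V : Matrix.unitaryGroup (Fin N) ℂ) :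
    frobSq (1 - ((V⁻¹ * U : Matrix.unitaryGroup (Fin N) ℂ) : Matrix (Fin N) (Fin N) ℂ))
      = frobSq ((V : Matrix (Fin N) (Fin N) ℂ) - (U : Matrix (Fin N) (Fin N) ℂ)) := by
  have h1 : (1 : Matrix (Fin N) (Fin N) ℂ) - ((V⁻¹ * U : Matrix.unitaryGroup (Fin N) ℂ) : Matrix (Fin N) (Fin N) ℂ)
      = (V : Matrix (Fin N) (Fin N) ℂ)ᴴ * ((V : Matrix (Fin N) (Fin N) ℂ) - (U : Matrix (Fin N) (Fin N) ℂ)) := by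
    rw [mul_sub]
    have := Matrix.UnitaryGroup.star_mul_self V
    rw [Matrix.star_eq_conjTranspose] at this
    rw [this]; rfl
  have h2 : (V : Matrix (Fin N) (Fin N) ℂ) * (V : Matrix (Fin N) (Fin N) ℂ)ᴴ = 1 := by
    have := (Matrix.mem_unitaryGroup_iff).1 V.2
    rwa [Matrix.star_eq_conjTranspose] at this
  unfold frobSq
  rw [h1, Matrix.conjTranspose_mul, Matrix.conjTranspose_conjTranspose, Matrix.mul_assoc,
    ← Matrix.mul_assoc (V : Matrix (Fin N) (Fin N) ℂ), h2, Matrix.one_mul]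

instance borelU {N : ℕ} : BorelSpace (Matrix.unitaryGroup (Fin N) ℂ) := ⟨rfl⟩

theorem cont_frob {N : ℕ} : Continuous (fun U : Matrix.unitaryGroup (Fin N) ℂ =>
    frobSq (1 - (U : Matrix (Fin N) (Fin N) ℂ))) := by
  unfold frobSq
  have h : Continuous (fun U : Matrix.unitaryGroup (Fin N) ℂ => 
    (1 - (U : Matrix (Fin N) (Fin N) ℂ))) := continuous_const.sub continuous_subtype_val
  exact Complex.continuous_re.comp ((h.matrix_conjTranspose.matrix_mul h).matrix_trace)

theorem packing {N : ℕ} (μ : Measure (Matrix.unitaryGroup (Fin N) ℂ))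
    [IsProbabilityMeasure μ] [μ.IsMulLeftInvariant] {ι : Type} [Fintype ι] [DecidableEq ι]
    (S : Set (Matrix.unitaryGroup (Fin N) ℂ)) (c : Matrix.unitaryGroup (Fin N) ℂ → ι → ℝ)
    (hc : ∀ U ∈ S, ∀ k, |c U k| ≤ 1) (n : ℕ) (hn : 1 ≤ n) (r : ℝ)
    (hr : ∀ U ∈ S, ∀ V ∈ S, (∀ k, |c U k - c V k| ≤ 1 / n) →
      frobSq ((U : Matrix (Fin N) (Fin N) ℂ) - (V : Matrix (Fin N) (Fin N) ℂ)) ≤ r) :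
    μ.real S ≤ (2 * n + 1) ^ Fintype.card ι *
      μ.real {U | frobSq (1 - (U : Matrix (Fin N) (Fin N) ℂ)) ≤ r} := by
  set B := {U : Matrix.unitaryGroup (Fin N) ℂ | frobSq (1 - (U : Matrix (Fin N) (Fin N) ℂ)) ≤ r}
  have hn' : (0:ℝ) < n := by exact_mod_cast hn
  let q : Matrix.unitaryGroup (Fin N) ℂ → ι → ℤ := fun U k => ⌊c U k * n⌋
  let F : Finset (ι → ℤ) := Fintype.piFinset fun _ => Finset.Icc (-(n:ℤ)) n
  have hF : F.card = (2 * n + 1) ^ Fintype.card ι := by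
    simp only [F, Fintype.card_piFinset, Int.card_Icc, Finset.prod_const, Finset.card_univ]
    congr 1; omega
  have hq : ∀ U ∈ S, q U ∈ F := by
    intro U hU
    simp only [F, Fintype.mem_piFinset, Finset.mem_Icc, q]
    intro k
    have := abs_le.1 (hc U hU k)
    constructor
    · apply Int.le_floor.2; push_cast; nlinarith
    · have : ((⌊c U k * n⌋ : ℤ) : ℝ) ≤ n := (Int.floor_le _).trans (by nlinarith)
      exact_mod_cast this
  have hsub : S ⊆ ⋃ f ∈ F, (S ∩ q ⁻¹' {f}) := by
    intro U hU
    simp only [Set.mem_iUnion]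
    exact ⟨q U, hq U hU, hU, rfl⟩
  have hcell : ∀ f, μ.real (S ∩ q ⁻¹' {f}) ≤ μ.real B := by
    intro f
    rcases (S ∩ q ⁻¹' {f}).eq_empty_or_nonempty with h | ⟨V, hV, hVf⟩
    · rw [h]; simp
    · have : S ∩ q ⁻¹' {f} ⊆ (fun h => V⁻¹ * h) ⁻¹' B := by
        rintro U ⟨hU, hUf⟩
        simp only [Set.mem_preimage, B, Set.mem_ofPred_eq]
        rw [frobSq_translate]
        apply hr V hV U hU
        intro k
        have e : ⌊c V k * n⌋ = ⌊c U k * n⌋ := by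
          have : q V = q U := by
            rw [Set.mem_preimage, Set.mem_singleton_iff] at hVf hUf; rw [hVf, hUf]
          exact congrFun this k
        have := (Int.abs_sub_lt_one_of_floor_eq_floor e).le
        rw [← sub_mul, abs_mul, abs_of_pos hn'] at this
        rwa [le_div_iff₀ hn']
      calc _ ≤ μ.real ((fun h => V⁻¹ * h) ⁻¹' B) := measureReal_mono this
        _ = _ := by rw [measureReal_def, measure_preimage_mul, measureReal_def]
  calc μ.real S ≤ μ.real (⋃ f ∈ F, (S ∩ q ⁻¹' {f})) := measureReal_mono hsub (measure_ne_top _ _)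
    _ ≤ ∑ f ∈ F, μ.real (S ∩ q ⁻¹' {f}) := measureReal_biUnion_finset_le _ _
    _ ≤ ∑ f ∈ F, μ.real B := Finset.sum_le_sum fun f _ => hcell f
    _ = _ := by rw [Finset.sum_const, hF]; simp

theorem ball_pos {N : ℕ} (μ : Measure (Matrix.unitaryGroup (Fin N) ℂ))
    [IsProbabilityMeasure μ] [μ.IsMulLeftInvariant] :
    0 < μ.real {U | frobSq (1 - (U : Matrix (Fin N) (Fin N) ℂ)) ≤ 1 / 4} := by
  have h := packing (ι := Fin N × Fin N × Bool) μ Set.univ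
    (fun U k => if k.2.2 then ((U : Matrix (Fin N) (Fin N) ℂ) k.1 k.2.1).re
      else ((U : Matrix (Fin N) (Fin N) ℂ) k.1 k.2.1).im) ?_ (4 * N + 1) (by omega) (1/4) ?_
  · rw [probReal_univ] at h
    by_contra hh
    have := le_antisymm (not_lt.1 hh) measureReal_nonneg
    rw [this] at h
    norm_num at h
  · intro U _ k
    have := entry_norm_bound_of_unitary U.2 k.1 k.2.1
    show |if k.2.2 then _ else _| ≤ 1
    split_ifs
    · exact (Complex.abs_re_le_norm _).trans this
    · exact (Complex.abs_im_le_norm _).trans this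
  · intro U _ V _ h
    have hm : (0:ℝ) < ((4 * N + 1 : ℕ) : ℝ) := by positivity
    refine (frobSq_le _ (2 * (1 / ((4 * N + 1 : ℕ) : ℝ)) ^ 2) ?_).trans ?_
    · intro i j
      have h1 := sq_le_sq' (abs_le.1 (h (i, j, true))).1 (abs_le.1 (h (i, j, true))).2
      have h2 := sq_le_sq' (abs_le.1 (h (i, j, false))).1 (abs_le.1 (h (i, j, false))).2
      rw [← Complex.normSq_eq_norm_sq, Complex.normSq_apply]
      simp at h1 h2 ⊢
      nlinarith
    · rw [one_div, inv_pow, ← mul_assoc, ← div_eq_mul_inv, div_le_iff₀ (by positivity)]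
      push_cast
      nlinarith [Nat.cast_nonneg (α := ℝ) N]

/-- anti-Hermitian part -/
noncomputable def skewPart {N : ℕ} (U : Matrix (Fin N) (Fin N) ℂ) : Matrix (Fin N) (Fin N) ℂ :=
  (1/2 : ℂ) • (U - Uᴴ)

/-- Hermitian part -/
noncomputable def hermPart {N : ℕ} (U : Matrix (Fin N) (Fin N) ℂ) : Matrix (Fin N) (Fin N) ℂ :=
  (1/2 : ℂ) • (U + Uᴴ)

theorem norm_half_le {N : ℕ} (A B : Matrix (Fin N) (Fin N) ℂ) (hA : ‖A‖ ≤ 1 / 2) (hB : ‖B‖ ≤ 1 / 2) :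
    ‖(1/2 : ℂ) • (A + B)‖ ≤ 1 / 2 := by
  let _ : NormedSpace ℂ (Matrix (Fin N) (Fin N) ℂ) := Matrix.frobeniusNormedSpace
  have h : ‖(1/2 : ℂ) • (A + B)‖ = ‖(1/2 : ℂ)‖ * ‖A + B‖ := norm_smul _ _
  have h2 := norm_add_le A B
  rw [h]; norm_num; linarith

theorem skew_bound {N : ℕ} (U : Matrix (Fin N) (Fin N) ℂ) (h : ‖1 - U‖ ≤ 1 / 2) :
    ‖skewPart U‖ ≤ 1 / 2 := by
  have e : skewPart U = (1/2 : ℂ) • (-(1 - U) + (1 - U)ᴴ) := by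
    simp [skewPart]
  rw [e]
  apply norm_half_le
  · rwa [norm_neg]
  · exact (Matrix.frobenius_norm_conjTranspose _).trans_le h

theorem herm_bound {N : ℕ} (U : Matrix (Fin N) (Fin N) ℂ) (h : ‖1 - U‖ ≤ 1 / 2) :
    ‖hermPart U - 1‖ ≤ 1 / 2 := by
  have e : hermPart U - 1 = (1/2 : ℂ) • (-(1 - U) + -(1 - U)ᴴ) := by
    ext i j
    simp [hermPart, Matrix.one_apply]
    split_ifs <;> simp_all <;> ring
  rw [e]
  apply norm_half_le
  · rwa [norm_neg]
  · rw [norm_neg]; exact (Matrix.frobenius_norm_conjTranspose _).trans_le h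

theorem herm_sq {N : ℕ} (U : Matrix.unitaryGroup (Fin N) ℂ) :
    hermPart (U : Matrix (Fin N) (Fin N) ℂ) * hermPart U = 1 + skewPart (U : Matrix (Fin N) (Fin N) ℂ) * skewPart U := by
  have h1 : (U : Matrix (Fin N) (Fin N) ℂ) * (U : Matrix (Fin N) (Fin N) ℂ)ᴴ = 1 := by
    have := (Matrix.mem_unitaryGroup_iff).1 U.2
    rwa [Matrix.star_eq_conjTranspose] at this
  have h2 : (U : Matrix (Fin N) (Fin N) ℂ)ᴴ * (U : Matrix (Fin N) (Fin N) ℂ) = 1 := by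
    have := (Matrix.mem_unitaryGroup_iff').1 U.2
    rwa [Matrix.star_eq_conjTranspose] at this
  simp only [hermPart, skewPart, smul_mul_smul_comm, add_mul, mul_add, sub_mul, mul_sub, h1, h2]
  module

theorem lip {N : ℕ} (U V : Matrix.unitaryGroup (Fin N) ℂ)
    (hU : ‖1 - (U : Matrix (Fin N) (Fin N) ℂ)‖ ≤ 1 / 2) (hV : ‖1 - (V : Matrix (Fin N) (Fin N) ℂ)‖ ≤ 1 / 2) :
    ‖(U : Matrix (Fin N) (Fin N) ℂ) - (V : Matrix (Fin N) (Fin N) ℂ)‖ ≤ 2 * ‖skewPart (U : Matrix (Fin N) (Fin N) ℂ) - skewPart V‖ := by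
  have eU : (U : Matrix (Fin N) (Fin N) ℂ) = hermPart U + skewPart U := by
    simp only [hermPart, skewPart]; module
  have eV : (V : Matrix (Fin N) (Fin N) ℂ) = hermPart V + skewPart V := by
    simp only [hermPart, skewPart]; module
  have a1 := skew_bound _ hU
  have a2 := skew_bound _ hV
  have k1 := herm_bound _ hU
  have k2 := herm_bound _ hV
  have s1 := herm_sq U
  have s2 := herm_sq V
  rw [show (U : Matrix (Fin N) (Fin N) ℂ) - (V : Matrix (Fin N) (Fin N) ℂ) = (hermPart (U : Matrix (Fin N) (Fin N) ℂ) - hermPart (V : Matrix (Fin N) (Fin N) ℂ)) + (skewPart (U : Matrix (Fin N) (Fin N) ℂ) - skewPart (V : Matrix (Fin N) (Fin N) ℂ)) by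
    calc _ = (hermPart (U : Matrix (Fin N) (Fin N) ℂ) + skewPart (U : Matrix (Fin N) (Fin N) ℂ)) - (hermPart (V : Matrix (Fin N) (Fin N) ℂ) + skewPart (V : Matrix (Fin N) (Fin N) ℂ)) := by rw [← eU, ← eV]
      _ = _ := by abel]
  generalize hermPart (U : Matrix (Fin N) (Fin N) ℂ) = H1 at *
  generalize hermPart (V : Matrix (Fin N) (Fin N) ℂ) = H2 at *
  generalize skewPart (U : Matrix (Fin N) (Fin N) ℂ) = A1 at *
  generalize skewPart (V : Matrix (Fin N) (Fin N) ℂ) = A2 at *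
  have key : (H1 - H2) + (H1 - H2) = (A1 * (A1 - A2) + (A1 - A2) * A2)
      - ((H1 - 1) * (H1 - H2) + (H1 - H2) * (H2 - 1)) := by
    have e : A1 * (A1 - A2) + (A1 - A2) * A2 = H1 * H1 - H2 * H2 := by
      rw [s1, s2]; noncomm_ring
    rw [e]; noncomm_ring
  have n0 : ‖(H1 - H2) + (H1 - H2)‖ = 2 * ‖H1 - H2‖ := by
    let _ : NormedSpace ℝ (Matrix (Fin N) (Fin N) ℂ) := Matrix.frobeniusNormedSpace
    rw [← two_smul ℝ]
    have h : ‖(2:ℝ) • (H1 - H2)‖ = ‖(2:ℝ)‖ * ‖H1 - H2‖ := norm_smul _ _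
    rw [h]; norm_num
  have n1 := norm_mul_le A1 (A1 - A2)
  have n2 := norm_mul_le (A1 - A2) A2
  have n3 := norm_mul_le (H1 - 1) (H1 - H2)
  have n4 := norm_mul_le (H1 - H2) (H2 - 1)
  have n5 := norm_sub_le (A1 * (A1 - A2) + (A1 - A2) * A2) ((H1 - 1) * (H1 - H2) + (H1 - H2) * (H2 - 1))
  have n6 := norm_add_le (A1 * (A1 - A2)) ((A1 - A2) * A2)
  have n7 := norm_add_le ((H1 - 1) * (H1 - H2)) ((H1 - H2) * (H2 - 1))
  have n8 := norm_add_le (H1 - H2) (A1 - A2)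
  rw [← key, n0] at n5
  have p1 := norm_nonneg (A1 - A2)
  have p2 := norm_nonneg (H1 - H2)
  nlinarith

theorem ball_lower {N : ℕ} (μ : Measure (Matrix.unitaryGroup (Fin N) ℂ))
    [IsProbabilityMeasure μ] [μ.IsMulLeftInvariant] (n : ℕ) (hn : 1 ≤ n) :
    μ.real {U | frobSq (1 - (U : Matrix (Fin N) (Fin N) ℂ)) ≤ 1 / 4} ≤
    (2 * n + 1) ^ (N ^ 2) *
      μ.real {U | frobSq (1 - (U : Matrix (Fin N) (Fin N) ℂ)) ≤ 8 * N ^ 2 / n ^ 2} := by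
  have hS : ∀ U : Matrix.unitaryGroup (Fin N) ℂ, frobSq (1 - (U : Matrix (Fin N) (Fin N) ℂ)) ≤ 1 / 4 →
      ‖1 - (U : Matrix (Fin N) (Fin N) ℂ)‖ ≤ 1 / 2 := by
    intro U h
    rw [frobSq_eq_norm] at h
    exact le_of_sq_le_sq (by linarith) (by norm_num)
  have h := packing (ι := Fin N × Fin N) μ
    {U | frobSq (1 - (U : Matrix (Fin N) (Fin N) ℂ)) ≤ 1 / 4}
    (fun U k => (skewPart (U : Matrix (Fin N) (Fin N) ℂ) k.1 k.2).re
      + (skewPart (U : Matrix (Fin N) (Fin N) ℂ) k.1 k.2).im) ?_ n hn (8 * N ^ 2 / n ^ 2) ?_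
  · simpa [sq] using h
  · intro U hU k
    have h1 := (entry_le_norm _ k.1 k.2).trans (skew_bound _ (hS U hU))
    have h2 := (Complex.abs_re_le_norm _).trans h1
    have h3 := (Complex.abs_im_le_norm _).trans h1
    exact (abs_add_le _ _).trans (by linarith)
  · intro U hU V hV h
    have hl := lip U V (hS U hU) (hS V hV)
    have hn' : (0:ℝ) < n := by exact_mod_cast hn
    have hA : frobSq (skewPart (U : Matrix (Fin N) (Fin N) ℂ) - skewPart V) ≤ N ^ 2 * (2 * (1 / n) ^ 2) := by
      apply frobSq_le
      intro i j
      have hij := abs_le.1 (h (i, j))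
      have hji := abs_le.1 (h (j, i))
      have e1 : (skewPart (U : Matrix (Fin N) (Fin N) ℂ) j i).re = -(skewPart (U : Matrix (Fin N) (Fin N) ℂ) i j).re := by
        simp [skewPart]; try ring
      have e2 : (skewPart (U : Matrix (Fin N) (Fin N) ℂ) j i).im = (skewPart (U : Matrix (Fin N) (Fin N) ℂ) i j).im := by
        simp [skewPart]; try ring
      have e3 : (skewPart (V : Matrix (Fin N) (Fin N) ℂ) j i).re = -(skewPart (V : Matrix (Fin N) (Fin N) ℂ) i j).re := by
        simp [skewPart]; try ring
      have e4 : (skewPart (V : Matrix (Fin N) (Fin N) ℂ) j i).im = (skewPart (V : Matrix (Fin N) (Fin N) ℂ) i j).im := by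
        simp [skewPart]; try ring
      dsimp only at hij hji
      rw [e1, e2, e3, e4] at hji
      rw [← Complex.normSq_eq_norm_sq, Complex.normSq_apply, Matrix.sub_apply, Complex.sub_re, Complex.sub_im]
      generalize (skewPart (U : Matrix (Fin N) (Fin N) ℂ) i j).re = x1 at *
      generalize (skewPart (U : Matrix (Fin N) (Fin N) ℂ) i j).im = y1 at *
      generalize (skewPart (V : Matrix (Fin N) (Fin N) ℂ) i j).re = x2 at *
      generalize (skewPart (V : Matrix (Fin N) (Fin N) ℂ) i j).im = y2 at *
      have q1 : (x1 - x2) ^ 2 ≤ (1 / (n:ℝ)) ^ 2 := sq_le_sq' (by linarith) (by linarith)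
      have q2 : (y1 - y2) ^ 2 ≤ (1 / (n:ℝ)) ^ 2 := sq_le_sq' (by linarith) (by linarith)
      linarith
    rw [frobSq_eq_norm] at hA ⊢
    calc _ ≤ (2 * ‖skewPart (U : Matrix (Fin N) (Fin N) ℂ) - skewPart V‖) ^ 2 :=
          pow_le_pow_left₀ (norm_nonneg _) hl 2
      _ = 4 * ‖skewPart (U : Matrix (Fin N) (Fin N) ℂ) - skewPart V‖ ^ 2 := by ring
      _ ≤ 4 * (N ^ 2 * (2 * (1 / n) ^ 2)) := by linarith
      _ = 8 * N ^ 2 / n ^ 2 := by ring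

end helpers

/-- lower bound on the single-bond pure-gauge partition function:
for `μ` the normalized Haar (probability) measure on `U(N)`, `d ∈ {2,3,4}` and `0 < g₀ < ∞`,
there is a constant `c = c(N,d,g₀) > 0` such that for all `a ∈ (0,1]` and `g² ∈ (0, g₀²]`,
`∫ exp(−(a^{d−4}/g²) ‖1 − U‖²_F) dμ(U) ≥ c (g² a^{4−d})^{N²/2}`. -/
theorem single_bond_partition_lower_bound (N : ℕ) (hN : 1 ≤ N)
    (d : ℕ) (hd : d ∈ ({2, 3, 4} : Set ℕ)) (g₀ : ℝ) (hg₀ : 0 < g₀)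
    (μ : Measure (Matrix.unitaryGroup (Fin N) ℂ))
    [IsProbabilityMeasure μ] [μ.IsMulLeftInvariant] :
    ∃ c > (0 : ℝ), ∀ a ∈ Set.Ioc (0 : ℝ) 1, ∀ g2 ∈ Set.Ioc (0 : ℝ) (g₀ ^ 2),
      c * (g2 * a ^ (4 - (d : ℝ))) ^ ((N ^ 2 : ℝ) / 2)
        ≤ ∫ U : Matrix.unitaryGroup (Fin N) ℂ,
            Real.exp (-(a ^ ((d : ℝ) - 4) / g2) *
              frobSq (1 - (U : Matrix (Fin N) (Fin N) ℂ))) ∂μ := by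
  have hm := ball_pos μ
  set m := μ.real {U | frobSq (1 - (U : Matrix (Fin N) (Fin N) ℂ)) ≤ 1 / 4} with hmdef
  have hN' : (1:ℝ) ≤ N := by exact_mod_cast hN
  set K : ℝ := 6 * N + 3 * g₀ with hK
  have hKpos : 0 < K := by positivity
  refine ⟨Real.exp (-1) * (m / K ^ (N ^ 2)), by positivity, ?_⟩
  rintro a ⟨ha0, ha1⟩ g2 ⟨hg0, hg1⟩
  have hd4 : (d : ℝ) ≤ 4 := by
    rcases hd with h | h | h <;> rw [h] <;> norm_num
  set t := g2 * a ^ (4 - (d : ℝ)) with ht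
  have ht0 : 0 < t := by positivity
  have htg : t ≤ g₀ ^ 2 := by
    have : a ^ (4 - (d : ℝ)) ≤ 1 := Real.rpow_le_one ha0.le ha1 (by linarith)
    nlinarith
  have hexp : a ^ ((d : ℝ) - 4) / g2 = 1 / t := by
    rw [ht, show (d:ℝ) - 4 = -(4 - (d:ℝ)) by ring, Real.rpow_neg ha0.le]
    field_simp
  rw [hexp]
  set s := Real.sqrt t with hs
  have hs0 : 0 < s := Real.sqrt_pos.2 ht0
  have hss : s ^ 2 = t := Real.sq_sqrt ht0.le
  have hsg : s ≤ g₀ := le_of_sq_le_sq (by rw [hss]; exact htg) hg₀.le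
  have hpow : t ^ ((N ^ 2 : ℝ) / 2) = s ^ (N ^ 2) := by
    rw [hs, Real.sqrt_eq_rpow, ← Real.rpow_natCast (t ^ (1/2 : ℝ)), ← Real.rpow_mul ht0.le]
    congr 1; push_cast; ring
  rw [hpow]
  set n := ⌈3 * N / s⌉₊ with hn
  have hn1 : 3 * N / s ≤ n := Nat.le_ceil _
  have hn2 : (n:ℝ) < 3 * N / s + 1 := Nat.ceil_lt_add_one (by positivity)
  have hnpos : 1 ≤ n := Nat.ceil_pos.2 (by positivity)
  have hnpos' : (0:ℝ) < n := by exact_mod_cast hnpos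
  have hball := ball_lower μ n hnpos
  rw [← hmdef] at hball
  have hsub : μ.real {U | frobSq (1 - (U : Matrix (Fin N) (Fin N) ℂ)) ≤ 8 * N ^ 2 / n ^ 2} ≤
      μ.real {U | frobSq (1 - (U : Matrix (Fin N) (Fin N) ℂ)) ≤ t} := by
    refine measureReal_mono ?_ (measure_ne_top _ _)
    intro U hU
    have hU' : frobSq (1 - (U : Matrix (Fin N) (Fin N) ℂ)) ≤ 8 * N ^ 2 / n ^ 2 := hU
    show frobSq (1 - (U : Matrix (Fin N) (Fin N) ℂ)) ≤ t
    refine le_trans hU' ?_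
    rw [div_le_iff₀ (by positivity), ← hss, ← mul_pow]
    rw [div_le_iff₀ hs0] at hn1
    have := pow_le_pow_left₀ (by positivity) hn1 2
    nlinarith
  have hcount : (2 * (n:ℝ) + 1) ≤ K / s := by
    rw [le_div_iff₀ hs0]
    have : (n:ℝ) * s < 3 * N + s := by
      calc (n:ℝ) * s < (3 * N / s + 1) * s := by gcongr
        _ = _ := by field_simp
    nlinarith
  set b := μ.real {U | frobSq (1 - (U : Matrix (Fin N) (Fin N) ℂ)) ≤ t} with hb
  have hmb : m / K ^ (N ^ 2) * s ^ (N ^ 2) ≤ b := by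
    have : m ≤ (K / s) ^ (N ^ 2) * b := by
      refine hball.trans ?_
      have : (0:ℝ) ≤ μ.real {U | frobSq (1 - (U : Matrix (Fin N) (Fin N) ℂ)) ≤ 8 * N ^ 2 / n ^ 2} :=
        measureReal_nonneg
      gcongr
    rw [div_pow, div_mul_eq_mul_div, le_div_iff₀ (by positivity)] at this
    rw [div_mul_eq_mul_div, div_le_iff₀ (by positivity)]
    linarith
  have hmeas : MeasurableSet {U : Matrix.unitaryGroup (Fin N) ℂ |
      frobSq (1 - (U : Matrix (Fin N) (Fin N) ℂ)) ≤ t} :=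
    (isClosed_le cont_frob continuous_const).measurableSet
  have hint : Integrable (fun U : Matrix.unitaryGroup (Fin N) ℂ =>
      Real.exp (-(1 / t) * frobSq (1 - (U : Matrix (Fin N) (Fin N) ℂ)))) μ := by
    refine Integrable.of_bound (C := 1) ?_ (Filter.Eventually.of_forall fun U => ?_)
    · exact (Real.continuous_exp.comp (continuous_const.mul cont_frob)).measurable.aestronglyMeasurable
    · rw [Real.norm_eq_abs, abs_of_pos (Real.exp_pos _), Real.exp_le_one_iff, neg_mul]
      have : 0 ≤ frobSq (1 - (U : Matrix (Fin N) (Fin N) ℂ)) := by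
        rw [frobSq_eq_sum]; positivity
      have : 0 ≤ 1 / t * frobSq (1 - (U : Matrix (Fin N) (Fin N) ℂ)) := by positivity
      linarith
  calc Real.exp (-1) * (m / K ^ (N ^ 2)) * s ^ (N ^ 2)
      = Real.exp (-1) * (m / K ^ (N ^ 2) * s ^ (N ^ 2)) := by ring
    _ ≤ Real.exp (-1) * b := by gcongr
    _ = ∫ U in {U : Matrix.unitaryGroup (Fin N) ℂ |
          frobSq (1 - (U : Matrix (Fin N) (Fin N) ℂ)) ≤ t}, Real.exp (-1) ∂μ := by
        rw [setIntegral_const, smul_eq_mul, mul_comm]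
    _ ≤ ∫ U in {U : Matrix.unitaryGroup (Fin N) ℂ |
          frobSq (1 - (U : Matrix (Fin N) (Fin N) ℂ)) ≤ t},
          Real.exp (-(1 / t) * frobSq (1 - (U : Matrix (Fin N) (Fin N) ℂ))) ∂μ := by
        refine setIntegral_mono_on (integrable_const _).integrableOn hint.integrableOn hmeas ?_
        intro U hU
        apply Real.exp_le_exp.2
        have : 1 / t * frobSq (1 - (U : Matrix (Fin N) (Fin N) ℂ)) ≤ 1 := by
          rw [div_mul_eq_mul_div, one_mul, div_le_one ht0]; exact hU
        linarith
    _ ≤ _ := setIntegral_le_integral hint (Filter.Eventually.of_forall fun U => (Real.exp_pos _).le)
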